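/- arXiv:1711.01805 — 2 statements merged into one kernel-verified Lean document; each statement's English description precedes it below -/
import Mathlib

section
/- Let λ₁, λ₂ ∈ (−1, 1], let a₁, a₂ > 0 be real numbers, set s₁ = i a₁ and s₂ = i a₂, and let α₁, α₂ > 0. Then the operators B(λ₁, s₁, α₁) and B(λ₂, s₂, α₂) on ℓ²(ℤ,ℂ) ⊕ ℓ²(ℤ,ℂ) are unitarily equivalent if and only if λ₁ = λ₂, a₁ = a₂ and α₁ = α₂. -/
noncomputable section

open ContinuousLinearMap

/-- The Hilbert space `ℓ²(ℤ, ℂ)`. -/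
abbrev H : Type := lp (fun _ : ℤ => ℂ) 2

/-- The standard orthonormal basis vectors of `ℓ²(ℤ, ℂ)`. -/
def e (n : ℤ) : H := lp.single 2 n 1

/-- The `2 × 2` upper-triangular block operator `[[T₁, S], [0, T₂]]` on the Hilbert space
direct sum `E ⊕ E = WithLp 2 (E × E)`. -/
def blockOp {E : Type*} [NormedAddCommGroup E] [NormedSpace ℂ E]
    (T₁ S T₂ : E →L[ℂ] E) : WithLp 2 (E × E) →L[ℂ] WithLp 2 (E × E) :=
  ((WithLp.prodContinuousLinearEquiv 2 ℂ E E).symm :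
      E × E →L[ℂ] WithLp 2 (E × E)) ∘L
    ((((T₁ ∘L fst ℂ E E) + (S ∘L snd ℂ E E)).prod (T₂ ∘L snd ℂ E E)) ∘L
      ((WithLp.prodContinuousLinearEquiv 2 ℂ E E) :
        WithLp 2 (E × E) →L[ℂ] E × E))

/-- Unitary equivalence of bounded operators on (possibly different) complex Hilbert spaces:
there is a unitary (= surjective linear isometry) `U` with `U A U⁻¹ = B`. -/
def UnitarilyEquiv {E F : Type*} [NormedAddCommGroup E] [NormedSpace ℂ E]
    [NormedAddCommGroup F] [NormedSpace ℂ F] (A : E →L[ℂ] E) (B : F →L[ℂ] F) : Prop :=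
  ∃ U : E ≃ₗᵢ[ℂ] F, ∀ x, U (A x) = B (U x)

/-- The Möbius transform `e^{iθ} (T - c·1)(1 - c̄·T)⁻¹` of an operator. -/
def mobius {E : Type*} [NormedAddCommGroup E] [NormedSpace ℂ E] [CompleteSpace E]
    (θ : ℝ) (c : ℂ) (T : E →L[ℂ] E) : E →L[ℂ] E :=
  Complex.exp (θ * Complex.I) •
    ((T - c • (1 : E →L[ℂ] E)) * Ring.inverse (1 - (starRingEnd ℂ c) • T))

/-- A bounded operator on a complex Hilbert space is homogeneous if its spectrum lies in the
closed unit disc and all its Möbius transforms are unitarily equivalent to it. -/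
def Homogeneous {E : Type*} [NormedAddCommGroup E] [NormedSpace ℂ E] [CompleteSpace E]
    (T : E →L[ℂ] E) : Prop :=
  spectrum ℂ T ⊆ Metric.closedBall 0 1 ∧
    ∀ (θ : ℝ) (c : ℂ), ‖c‖ < 1 →
      IsUnit (1 - (starRingEnd ℂ c) • T) ∧ UnitarilyEquiv (mobius θ c T) T

/-- A bounded operator is irreducible if the only closed subspaces invariant under both the
operator and its adjoint are `{0}` and the whole space. -/
def IrreducibleOp {E : Type*} [NormedAddCommGroup E] [InnerProductSpace ℂ E] [CompleteSpace E]
    (T : E →L[ℂ] E) : Prop :=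
  ∀ M : Submodule ℂ E, IsClosed (M : Set E) → (∀ x ∈ M, T x ∈ M) →
    (∀ x ∈ M, ContinuousLinearMap.adjoint T x ∈ M) → M = ⊥ ∨ M = ⊤

/-- Weight sequence of the shift `B_{λ, ia}`. -/
def wB (l a : ℝ) (n : ℤ) : ℂ :=
  ((n : ℂ) + (1 + (l : ℂ)) / 2 + Complex.I * (a : ℂ)) /
    ((n : ℂ) + (1 + (l : ℂ)) / 2 - Complex.I * (a : ℂ))

/-- Weight sequence of the shift `T(a, b)`. -/
def wT (a b : ℝ) (n : ℤ) : ℂ := (Real.sqrt (((n : ℝ) + a) / ((n : ℝ) + b)) : ℂ)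

/-- Weight sequence of the shift `S[λ]`. -/
def wS (l : ℝ) (n : ℤ) : ℂ := ((l : ℂ) + 2 * (n : ℂ) + 1)⁻¹

open scoped ComplexConjugate

lemma hasSum_smul_e (f : H) : HasSum (fun i : ℤ => f i • e i) f := by
  convert lp.hasSum_single (p := 2) (by norm_num) f using 2 with i
  simp [e, ← lp.single_smul]

lemma ext_e {A B : H →L[ℂ] H} (h : ∀ n, A (e n) = B (e n)) : A = B := by
  ext1 f
  refine ((hasSum_smul_e f).mapL A).unique ?_
  simpa [h] using (hasSum_smul_e f).mapL B

lemma e_apply (n k : ℤ) : e n k = if k = n then 1 else 0 := by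
  simp [e, Pi.single_apply]

lemma inner_e_left (n : ℤ) (f : H) : inner ℂ (e n) f = f n := by
  simp [e, lp.inner_single_left]

lemma weightedShift_apply {w : ℤ → ℂ} {A : H →L[ℂ] H}
    (hA : ∀ n, A (e n) = w n • e (n + 1)) (f : H) (n : ℤ) : A f (n + 1) = w n * f n := by
  have h₁ := ((hasSum_smul_e f).mapL A).mapL (lp.evalCLM ℂ (fun _ : ℤ => ℂ) 2 (n + 1))
  have h₂ := hasSum_single (f := fun i : ℤ => lp.evalCLM ℂ (fun _ : ℤ => ℂ) 2 (n + 1)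
    (A (f i • e i))) n fun i hi => by simp [hA, lp.evalCLM, e_apply, Ne.symm hi]
  simpa [hA, lp.evalCLM, e_apply, mul_comm] using h₁.unique h₂

lemma adjoint_map {E F : Type*} [NormedAddCommGroup E] [InnerProductSpace ℂ E] [CompleteSpace E]
    [NormedAddCommGroup F] [InnerProductSpace ℂ F] [CompleteSpace F]
    {A : E →L[ℂ] E} {B : F →L[ℂ] F} (U : E ≃ₗᵢ[ℂ] F) (h : ∀ x, U (A x) = B (U x)) (x : E) :
    U (adjoint A x) = adjoint B (U x) := by
  refine ext_inner_right ℂ fun y => ?_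
  obtain ⟨z, rfl⟩ := U.surjective y
  rw [U.inner_map_map, adjoint_inner_left, adjoint_inner_left, ← h, U.inner_map_map]

lemma blockOp_apply_fst {E : Type*} [NormedAddCommGroup E] [NormedSpace ℂ E]
    (T₁ S T₂ : E →L[ℂ] E) (u : WithLp 2 (E × E)) :
    (blockOp T₁ S T₂ u).fst = T₁ u.fst + S u.snd := rfl

lemma blockOp_apply_snd {E : Type*} [NormedAddCommGroup E] [NormedSpace ℂ E]
    (T₁ S T₂ : E →L[ℂ] E) (u : WithLp 2 (E × E)) :
    (blockOp T₁ S T₂ u).snd = T₂ u.snd := rfl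

lemma prod_ext {u v : WithLp 2 (H × H)} (h₁ : ∀ n, u.fst n = v.fst n)
    (h₂ : ∀ n, u.snd n = v.snd n) : u = v :=
  WithLp.ofLp_injective 2 (Prod.ext (lp.ext (funext h₁)) (lp.ext (funext h₂)))

/-- `S` acts on the `n`-th copy of `ℂ²` in `H ⊕ H` by a matrix of determinant `1` and
trace `τ n`. -/
def IsFiberwise (S : WithLp 2 (H × H) →L[ℂ] WithLp 2 (H × H)) (τ : ℤ → ℂ) : Prop :=
  ∀ n, ∃ a b c d : ℂ, a * d - b * c = 1 ∧ a + d = τ n ∧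
    ∀ u, (S u).fst n = a * u.fst n + b * u.snd n ∧ (S u).snd n = c * u.fst n + d * u.snd n

namespace IsFiberwise

variable {S S' : WithLp 2 (H × H) →L[ℂ] WithLp 2 (H × H)} {τ τ' : ℤ → ℂ}

lemma cayleyHamilton (h : IsFiberwise S τ) (u : WithLp 2 (H × H)) (n : ℤ) :
    (S (S u) + u).fst n = τ n * (S u).fst n ∧ (S (S u) + u).snd n = τ n * (S u).snd n := by
  obtain ⟨a, b, c, d, hdet, htr, hS⟩ := h n
  simp only [WithLp.add_fst, WithLp.add_snd, lp.coeFn_add, Pi.add_apply, (hS _).1, (hS _).2,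
    ← htr]
  constructor
  · linear_combination (-u.fst n) * hdet
  · linear_combination (-u.snd n) * hdet

lemma cayleyHamilton_single (h : IsFiberwise S τ) (n : ℤ) :
    S (S (WithLp.toLp 2 (e n, 0))) + WithLp.toLp 2 (e n, 0) =
      τ n • S (WithLp.toLp 2 (e n, 0)) := by
  have key (k : ℤ) (hk : k ≠ n) : (S (WithLp.toLp 2 (e n, 0))).fst k = 0 ∧
      (S (WithLp.toLp 2 (e n, 0))).snd k = 0 := by
    obtain ⟨a, b, c, d, -, -, hS⟩ := h k
    simp [hS, e_apply, hk]
  refine prod_ext (fun k => ?_) fun k => ?_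
  · rw [(h.cayleyHamilton _ k).1]
    by_cases hk : k = n
    · simp [hk]
    · simp [key k hk]
  · rw [(h.cayleyHamilton _ k).2]
    by_cases hk : k = n
    · simp [hk]
    · simp [key k hk]

lemma trace_eq (h : IsFiberwise S τ) (h' : IsFiberwise S' τ')
    (U : WithLp 2 (H × H) ≃ₗᵢ[ℂ] WithLp 2 (H × H)) (hU : ∀ x, U (S x) = S' (U x)) {n m : ℤ}
    (hm : ¬((U (WithLp.toLp 2 (e n, 0))).fst m = 0 ∧ (U (WithLp.toLp 2 (e n, 0))).snd m = 0)) :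
    τ n = τ' m := by
  have h₁ := congrArg U (h.cayleyHamilton_single n)
  rw [map_add, map_smul, hU, hU] at h₁
  generalize U (WithLp.toLp 2 (e n, 0)) = v at h₁ hm
  have h₂ := h'.cayleyHamilton v m
  rw [h₁] at h₂
  by_contra hne
  obtain ⟨a, b, c, d, hdet, -, hS⟩ := h' m
  have hf : (S' v).fst m = 0 := by
    have := h₂.1
    simpa [hne] using this
  have hs : (S' v).snd m = 0 := by
    have := h₂.2
    simpa [hne] using this
  rw [(hS v).1] at hf
  rw [(hS v).2] at hs
  refine hm ⟨?_, ?_⟩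
  · linear_combination d * hf - b * hs - v.fst m * hdet
  · linear_combination a * hs - c * hf - v.snd m * hdet

end IsFiberwise

/-- The operator `[[A, α (A - B₀)], [0, B₀]]` on `H ⊕ H`. -/
abbrev shiftBlock (α : ℝ) (A B₀ : H →L[ℂ] H) : WithLp 2 (H × H) →L[ℂ] WithLp 2 (H × H) :=
  blockOp A ((α : ℂ) • (A - B₀)) B₀

/-- The number `α² |w n - 1|²`. -/
def weightGap (α : ℝ) (w : ℤ → ℂ) (n : ℤ) : ℂ := α ^ 2 * ((w n - 1) * (conj (w n) - 1))

section shiftBlock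

variable {w : ℤ → ℂ} {α : ℝ} {A B₀ : H →L[ℂ] H}

lemma shiftBlock_fst (h₀ : ∀ n, B₀ (e n) = e (n + 1)) (hA : ∀ n, A (e n) = w n • e (n + 1))
    (u : WithLp 2 (H × H)) (n : ℤ) :
    (shiftBlock α A B₀ u).fst (n + 1) = w n * u.fst n + α * (w n - 1) * u.snd n := by
  have h₁ := weightedShift_apply (w := 1) (A := B₀) (by simpa using h₀)
  have h₂ := weightedShift_apply hA
  rw [blockOp_apply_fst, FunLike.coe_smul, Pi.smul_apply, sub_apply]
  simp only [lp.coeFn_add, lp.coeFn_smul, lp.coeFn_sub, Pi.add_apply, Pi.smul_apply,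
    Pi.sub_apply, h₁, h₂, Pi.one_apply, smul_eq_mul]
  ring

lemma shiftBlock_snd (h₀ : ∀ n, B₀ (e n) = e (n + 1)) (u : WithLp 2 (H × H)) (n : ℤ) :
    (shiftBlock α A B₀ u).snd (n + 1) = u.snd n := by
  simp [blockOp_apply_snd, weightedShift_apply (w := 1) (A := B₀) (by simpa using h₀)]

lemma adjoint_shiftBlock_fst (hA : ∀ n, A (e n) = w n • e (n + 1))
    (u : WithLp 2 (H × H)) (n : ℤ) :
    (adjoint (shiftBlock α A B₀) u).fst n = conj (w n) * u.fst (n + 1) := by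
  have h := adjoint_inner_right (shiftBlock α A B₀) (WithLp.toLp 2 (e n, 0)) u
  simpa [WithLp.prod_inner_apply, inner_e_left, blockOp_apply_fst, blockOp_apply_snd, hA,
    inner_smul_left] using h

lemma adjoint_shiftBlock_snd (h₀ : ∀ n, B₀ (e n) = e (n + 1))
    (hA : ∀ n, A (e n) = w n • e (n + 1)) (u : WithLp 2 (H × H)) (n : ℤ) :
    (adjoint (shiftBlock α A B₀) u).snd n =
      α * (conj (w n) - 1) * u.fst (n + 1) + u.snd (n + 1) := by
  have h := adjoint_inner_right (shiftBlock α A B₀) (WithLp.toLp 2 (0, e n)) u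
  simp only [WithLp.prod_inner_apply, WithLp.ofLp_fst, WithLp.ofLp_snd, blockOp_apply_fst,
    blockOp_apply_snd, WithLp.toLp_fst, WithLp.toLp_snd, map_zero, zero_add, inner_zero_left,
    FunLike.coe_smul, Pi.smul_apply, sub_apply, h₀, hA, inner_smul_left, inner_sub_left,
    inner_e_left, Complex.conj_ofReal] at h
  rw [h]
  ring

lemma isFiberwise_adjoint_comp_self (h₀ : ∀ n, B₀ (e n) = e (n + 1))
    (hA : ∀ n, A (e n) = w n • e (n + 1)) (hw : ∀ n, w n * conj (w n) = 1) :
    IsFiberwise (adjoint (shiftBlock α A B₀) ∘L shiftBlock α A B₀)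
      fun n => 2 + weightGap α w n := by
  intro n
  refine ⟨1, α * (1 - conj (w n)), α * (1 - w n), 1 + weightGap α w n, ?_, ?_, fun u => ?_⟩
  · rw [weightGap]; ring
  · ring
  · rw [comp_apply, adjoint_shiftBlock_fst hA, adjoint_shiftBlock_snd h₀ hA,
      shiftBlock_fst h₀ hA, shiftBlock_snd h₀, weightGap]
    constructor
    · linear_combination (u.fst n + α * u.snd n) * hw n
    · linear_combination (α * u.fst n) * hw n

lemma isFiberwise_comp_adjoint_self (h₀ : ∀ n, B₀ (e n) = e (n + 1))
    (hA : ∀ n, A (e n) = w n • e (n + 1)) (hw : ∀ n, w n * conj (w n) = 1) :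
    IsFiberwise (shiftBlock α A B₀ ∘L adjoint (shiftBlock α A B₀))
      fun n => 2 + weightGap α w (n - 1) := by
  intro n
  obtain ⟨n, rfl⟩ : ∃ k, n = k + 1 := ⟨n - 1, by ring⟩
  refine ⟨1 + weightGap α w n, α * (w n - 1), α * (conj (w n) - 1), 1, ?_, ?_, fun u => ?_⟩
  · rw [weightGap]; ring
  · simp only [add_sub_cancel_right]; ring
  · rw [comp_apply, shiftBlock_fst h₀ hA, shiftBlock_snd h₀, adjoint_shiftBlock_fst hA,
      adjoint_shiftBlock_snd h₀ hA, weightGap]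
    constructor
    · linear_combination u.fst (n + 1) * hw n
    · ring

end shiftBlock

lemma UnitarilyEquiv.symm {E F : Type*} [NormedAddCommGroup E] [NormedSpace ℂ E]
    [NormedAddCommGroup F] [NormedSpace ℂ F] {A : E →L[ℂ] E} {B : F →L[ℂ] F}
    (h : UnitarilyEquiv A B) : UnitarilyEquiv B A := by
  obtain ⟨U, hU⟩ := h
  exact ⟨U.symm, fun x => U.injective (by simp [hU])⟩

lemma UnitarilyEquiv.exists_weightGap_eq {w w' : ℤ → ℂ} {α α' : ℝ} {A A' B₀ : H →L[ℂ] H}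
    (h : UnitarilyEquiv (shiftBlock α A B₀) (shiftBlock α' A' B₀))
    (h₀ : ∀ n, B₀ (e n) = e (n + 1)) (hA : ∀ n, A (e n) = w n • e (n + 1))
    (hw : ∀ n, w n * conj (w n) = 1) (hA' : ∀ n, A' (e n) = w' n • e (n + 1))
    (hw' : ∀ n, w' n * conj (w' n) = 1) (n : ℤ) :
    ∃ m, weightGap α w n = weightGap α' w' m ∧
      weightGap α w (n - 1) = weightGap α' w' (m - 1) := by
  obtain ⟨U, hU⟩ := h
  have hU' := adjoint_map U hU
  obtain ⟨m, hm⟩ : ∃ m, ¬((U (WithLp.toLp 2 (e n, 0))).fst m = 0 ∧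
      (U (WithLp.toLp 2 (e n, 0))).snd m = 0) := by
    by_contra! hz
    have h₁ : U (WithLp.toLp 2 (e n, 0)) = 0 :=
      prod_ext (fun m => by simpa using (hz m).1) fun m => by simpa using (hz m).2
    have h₂ := congrArg (fun v : WithLp 2 (H × H) => v.fst n) (U.map_eq_zero_iff.1 h₁)
    simp [e_apply] at h₂
  refine ⟨m, ?_, ?_⟩
  · simpa using (isFiberwise_adjoint_comp_self h₀ hA hw).trace_eq
      (isFiberwise_adjoint_comp_self h₀ hA' hw') U (fun x => by simp only [comp_apply, hU, hU']) hm
  · simpa using (isFiberwise_comp_adjoint_self h₀ hA hw).trace_eq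
      (isFiberwise_comp_adjoint_self h₀ hA' hw') U (fun x => by simp only [comp_apply, hU, hU']) hm

lemma wB_denom_ne_zero {l a : ℝ} (ha : 0 < a) (n : ℤ) :
    ((n : ℂ) + (1 + (l : ℂ)) / 2 - Complex.I * (a : ℂ)) ≠ 0 ∧
      ((n : ℂ) + (1 + (l : ℂ)) / 2 + Complex.I * (a : ℂ)) ≠ 0 := by
  have hx : (n : ℂ) + (1 + (l : ℂ)) / 2 = ((n + (1 + l) / 2 : ℝ) : ℂ) := by push_cast; ring
  rw [hx]
  constructor <;> intro h <;> simpa [ha.ne'] using congrArg Complex.im h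

lemma conj_wB (l a : ℝ) (n : ℤ) :
    conj (wB l a n) = ((n : ℂ) + (1 + (l : ℂ)) / 2 - Complex.I * (a : ℂ)) /
      ((n : ℂ) + (1 + (l : ℂ)) / 2 + Complex.I * (a : ℂ)) := by
  simp [wB, sub_eq_add_neg, Complex.conj_ofNat]

lemma wB_mul_conj {l a : ℝ} (ha : 0 < a) (n : ℤ) : wB l a n * conj (wB l a n) = 1 := by
  obtain ⟨h₁, h₂⟩ := wB_denom_ne_zero (l := l) ha n
  rw [conj_wB, wB, div_mul_div_comm, mul_comm, div_self (mul_ne_zero h₁ h₂)]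

lemma weightGap_wB {l a : ℝ} (ha : 0 < a) (α : ℝ) (n : ℤ) :
    weightGap α (wB l a) n =
      ((4 * α ^ 2 * a ^ 2 / ((n + (1 + l) / 2) ^ 2 + a ^ 2) : ℝ) : ℂ) := by
  obtain ⟨h₁, h₂⟩ := wB_denom_ne_zero (l := l) ha n
  have h₃ : ((n : ℂ) + (1 + (l : ℂ)) / 2) ^ 2 + a ^ 2 =
      ((n : ℂ) + (1 + (l : ℂ)) / 2 - Complex.I * (a : ℂ)) *
        ((n : ℂ) + (1 + (l : ℂ)) / 2 + Complex.I * (a : ℂ)) := by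
    linear_combination (a : ℂ) ^ 2 * Complex.I_sq
  push_cast
  rw [h₃, weightGap, conj_wB, wB, div_sub_one h₁, div_sub_one h₂, div_mul_div_comm,
    mul_div_assoc']
  congr 1
  linear_combination (-4 * (α : ℂ) ^ 2 * (a : ℂ) ^ 2) * Complex.I_sq

/-- Equality of weight gaps, expressed through their reciprocals. -/
lemma weightGap_wB_eq_iff {l l' a a' α α' : ℝ} (ha : 0 < a) (ha' : 0 < a')
    (n m : ℤ) :
    weightGap α (wB l a) n = weightGap α' (wB l' a') m ↔
      (4 * α ^ 2 * a ^ 2)⁻¹ * ((n + (1 + l) / 2) ^ 2 + a ^ 2) =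
        (4 * α' ^ 2 * a' ^ 2)⁻¹ * ((m + (1 + l') / 2) ^ 2 + a' ^ 2) := by
  rw [weightGap_wB ha, weightGap_wB ha', Complex.ofReal_inj, ← inv_inj, inv_div, inv_div,
    div_eq_inv_mul _ (4 * α ^ 2 * a ^ 2), div_eq_inv_mul _ (4 * α' ^ 2 * a' ^ 2)]

/-- If the increments `p (2 n + l)` of one parabola are among the increments of another one,
then the scale factors are commensurable. -/
lemma exists_pos_int_mul {p p' l l' : ℝ} (hp : 0 < p) (hp' : 0 < p')
    (h : ∀ n : ℤ, ∃ m : ℤ, p * (2 * n + l) = p' * (2 * m + l')) :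
    ∃ k : ℤ, 1 ≤ k ∧ p = k * p' := by
  obtain ⟨m₀, h₀⟩ := h 0
  obtain ⟨m₁, h₁⟩ := h 1
  push_cast at h₀ h₁
  have hk : p = ((m₁ - m₀ : ℤ) : ℝ) * p' := by
    push_cast; linarith
  refine ⟨m₁ - m₀, ?_, hk⟩
  have : (0 : ℝ) < ((m₁ - m₀ : ℤ) : ℝ) := pos_of_mul_pos_left (hk ▸ hp) hp'.le
  exact_mod_cast this

lemma scale_le {p p' l l' : ℝ} (hp : 0 < p) (hp' : 0 < p')
    (h : ∀ n : ℤ, ∃ m : ℤ, p * (2 * n + l) = p' * (2 * m + l')) : p' ≤ p := by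
  obtain ⟨k, hk, rfl⟩ := exists_pos_int_mul hp hp' h
  have : (1 : ℝ) ≤ k := by exact_mod_cast hk
  nlinarith

lemma UnitarilyEquiv.exists_parabola_eq {l l' a a' α α' : ℝ} {A A' B₀ : H →L[ℂ] H}
    (h : UnitarilyEquiv (shiftBlock α A B₀) (shiftBlock α' A' B₀))
    (ha : 0 < a) (ha' : 0 < a')
    (h₀ : ∀ n, B₀ (e n) = e (n + 1)) (hA : ∀ n, A (e n) = wB l a n • e (n + 1))
    (hA' : ∀ n, A' (e n) = wB l' a' n • e (n + 1)) (n : ℤ) :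
    ∃ m : ℤ, (4 * α ^ 2 * a ^ 2)⁻¹ * (2 * n + l) = (4 * α' ^ 2 * a' ^ 2)⁻¹ * (2 * m + l') ∧
      (4 * α ^ 2 * a ^ 2)⁻¹ * ((n + (1 + l) / 2) ^ 2 + a ^ 2) =
        (4 * α' ^ 2 * a' ^ 2)⁻¹ * ((m + (1 + l') / 2) ^ 2 + a' ^ 2) := by
  obtain ⟨m, h₁, h₂⟩ := h.exists_weightGap_eq h₀ hA (wB_mul_conj ha) hA' (wB_mul_conj ha') n
  rw [weightGap_wB_eq_iff ha ha'] at h₁ h₂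
  refine ⟨m, ?_, h₁⟩
  push_cast at h₂
  linear_combination h₁ - h₂

/-- `B(λ₁, ia₁, α₁)` and `B(λ₂, ia₂, α₂)` are unitarily equivalent iff
`λ₁ = λ₂`, `a₁ = a₂` and `α₁ = α₂`. -/
theorem stmt1 (l₁ l₂ : ℝ) (hl₁ : -1 < l₁ ∧ l₁ ≤ 1) (hl₂ : -1 < l₂ ∧ l₂ ≤ 1)
    (a₁ a₂ α₁ α₂ : ℝ) (ha₁ : 0 < a₁) (ha₂ : 0 < a₂) (hα₁ : 0 < α₁) (hα₂ : 0 < α₂)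
    (B₀ B₁ B₂ : H →L[ℂ] H)
    (hB₀ : ∀ n : ℤ, B₀ (e n) = e (n + 1))
    (hB₁ : ∀ n : ℤ, B₁ (e n) = wB l₁ a₁ n • e (n + 1))
    (hB₂ : ∀ n : ℤ, B₂ (e n) = wB l₂ a₂ n • e (n + 1)) :
    UnitarilyEquiv (blockOp B₁ ((α₁ : ℂ) • (B₁ - B₀)) B₀)
        (blockOp B₂ ((α₂ : ℂ) • (B₂ - B₀)) B₀) ↔
      l₁ = l₂ ∧ a₁ = a₂ ∧ α₁ = α₂ := by
  constructor
  · intro h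
    have h₁ := h.exists_parabola_eq ha₁ ha₂ hB₀ hB₁ hB₂
    have h₂ := h.symm.exists_parabola_eq ha₂ ha₁ hB₀ hB₂ hB₁
    have hp₁ : 0 < (4 * α₁ ^ 2 * a₁ ^ 2)⁻¹ := by positivity
    have hp₂ : 0 < (4 * α₂ ^ 2 * a₂ ^ 2)⁻¹ := by positivity
    have hp : (4 * α₁ ^ 2 * a₁ ^ 2)⁻¹ = (4 * α₂ ^ 2 * a₂ ^ 2)⁻¹ :=
      le_antisymm (scale_le hp₂ hp₁ fun n => (h₂ n).imp fun _ => And.left)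
        (scale_le hp₁ hp₂ fun n => (h₁ n).imp fun _ => And.left)
    obtain ⟨m, hm, hq⟩ := h₁ 0
    rw [hp] at hm hq
    have hm := mul_left_cancel₀ hp₂.ne' hm
    have hq := mul_left_cancel₀ hp₂.ne' hq
    push_cast at hm hq
    have hm₁ : m < 1 := by
      have : (m : ℝ) < 1 := by linarith
      exact_mod_cast this
    have hm₂ : -1 < m := by
      have : (-1 : ℝ) < m := by linarith
      exact_mod_cast this
    obtain rfl : m = 0 := by lia
    have hl : l₁ = l₂ := by simpa using hm
    subst hl
    have ha : a₁ = a₂ := by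
      rw [← sq_eq_sq₀ ha₁.le ha₂.le]
      simpa using hq
    subst ha
    refine ⟨rfl, rfl, ?_⟩
    rw [← sq_eq_sq₀ hα₁.le hα₂.le]
    simpa [ha₁.ne'] using hp
  · rintro ⟨rfl, rfl, rfl⟩
    obtain rfl : B₁ = B₂ := ext_e fun n => by rw [hB₁, hB₂]
    exact ⟨LinearIsometryEquiv.refl ℂ _, fun _ => rfl⟩
end
end

section
/- For every 0 < a < b < 1 and α > 0, and for every λ ∈ (−1, 1) and β > 0, the operators T(a, b, α) and B(λ, β) on ℓ²(ℤ,ℂ) ⊕ ℓ²(ℤ,ℂ) are not unitarily equivalent. -/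
noncomputable section

open ContinuousLinearMap

/-- A continuous linear operator on `ℓ²(ℤ, ℂ)` fixing every basis vector is the identity. -/
lemma eq_one_of_apply_e {A : H →L[ℂ] H} (hA : ∀ n : ℤ, A (e n) = e n) : A = 1 := by
  refine ContinuousLinearMap.ext fun x => ?_
  have hx : HasSum (fun n : ℤ => x n • e n) x := by
    simpa [e, ← lp.single_smul] using lp.hasSum_single (by simp) x
  have h := A.hasSum hx
  simp only [map_smul, hA] at h
  exact h.unique hx

lemma inner_e (m n : ℤ) : inner ℂ (e m) (e n) = if m = n then (1 : ℂ) else 0 := by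
  rw [e, lp.inner_single_left, e, lp.single_apply]
  by_cases h : m = n
  · subst h; simp
  · simp [h]

/-- The bilateral shift is isometric. -/
lemma norm_shift_apply {B₀ : H →L[ℂ] H} (hB₀ : ∀ n : ℤ, B₀ (e n) = e (n + 1)) (x : H) :
    ‖B₀ x‖ = ‖x‖ := by
  refine (norm_map_iff_adjoint_comp_self B₀).2 (eq_one_of_apply_e fun n => ?_) x
  refine lp.ext (funext fun m => ?_)
  have h (y : H) : y m = inner ℂ (e m) y := by simp [e, lp.inner_single_left]
  rw [h, h, comp_apply, adjoint_inner_right, hB₀, hB₀, inner_e, inner_e]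
  simp

section blockOp

variable {E : Type*} [NormedAddCommGroup E] [NormedSpace ℂ E] (T₁ S T₂ : E →L[ℂ] E)

lemma blockOp_fst (v : WithLp 2 (E × E)) : (blockOp T₁ S T₂ v).fst = T₁ v.fst + S v.snd := rfl

lemma blockOp_snd (v : WithLp 2 (E × E)) : (blockOp T₁ S T₂ v).snd = T₂ v.snd := rfl

lemma blockOp_toLp_zero (x : E) :
    blockOp T₁ S T₂ (WithLp.toLp 2 (x, 0)) = WithLp.toLp 2 (T₁ x, 0) := by
  simp [blockOp]

variable {T₁ S T₂}

lemma norm_snd_iterate_blockOp (h₂ : ∀ x, ‖T₂ x‖ = ‖x‖) (n : ℕ) (v : WithLp 2 (E × E)) :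
    ‖((blockOp T₁ S T₂)^[n] v).snd‖ = ‖v.snd‖ := by
  induction n with
  | zero => rfl
  | succ n ih => rw [Function.iterate_succ_apply', blockOp_snd, h₂, ih]

lemma norm_fst_iterate_blockOp (h₁ : ∀ x, ‖T₁ x‖ = ‖x‖) (h₂ : ∀ x, ‖T₂ x‖ = ‖x‖) (n : ℕ)
    {v : WithLp 2 (E × E)} (hv : v.snd = 0) :
    ‖((blockOp T₁ S T₂)^[n] v).fst‖ = ‖v.fst‖ := by
  induction n with
  | zero => rfl
  | succ n ih =>
    have h : ((blockOp T₁ S T₂)^[n] v).snd = 0 := by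
      rw [← norm_eq_zero, norm_snd_iterate_blockOp h₂, hv, norm_zero]
    rw [Function.iterate_succ_apply', blockOp_fst, h, map_zero, add_zero, h₁, ih]

/-- An upper-triangular block operator with isometric diagonal entries has no nonzero stable
vector. -/
lemma eq_zero_of_tendsto_iterate_blockOp (h₁ : ∀ x, ‖T₁ x‖ = ‖x‖) (h₂ : ∀ x, ‖T₂ x‖ = ‖x‖)
    {v : WithLp 2 (E × E)}
    (hv : Filter.Tendsto (fun n => (blockOp T₁ S T₂)^[n] v) Filter.atTop (nhds 0)) : v = 0 := by
  have hv' := hv.norm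
  rw [norm_zero] at hv'
  have hs : v.snd = 0 := by
    rw [← norm_le_zero_iff]
    refine ge_of_tendsto' hv' fun n => ?_
    rw [← norm_snd_iterate_blockOp (T₁ := T₁) (S := S) h₂ n v]
    exact WithLp.norm_snd_le E _
  have hf : v.fst = 0 := by
    rw [← norm_le_zero_iff]
    refine ge_of_tendsto' hv' fun n => ?_
    rw [← norm_fst_iterate_blockOp (S := S) h₁ h₂ n hs]
    exact WithLp.norm_fst_le E _
  exact WithLp.ofLp_injective 2 (Prod.ext hf hs)

end blockOp

lemma tendsto_prod_range_add_div_add {a b : ℝ} (ha : 0 < a) (hab : a < b) (hb : b < 1) :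
    Filter.Tendsto (fun n : ℕ => ∏ k ∈ Finset.range n, ((k : ℝ) + a) / ((k : ℝ) + b))
      Filter.atTop (nhds 0) := by
  have hsum : Filter.Tendsto
      (fun n : ℕ => -((b - a) * ∑ k ∈ Finset.range n, 1 / ((k : ℝ) + 1)))
      Filter.atTop Filter.atBot :=
    Filter.tendsto_neg_atTop_atBot.comp
      (Real.tendsto_sum_range_one_div_nat_succ_atTop.const_mul_atTop (sub_pos.2 hab))
  refine squeeze_zero (fun n => Finset.prod_nonneg fun k _ => ?_) (fun n => ?_)
    (Real.tendsto_exp_atBot.comp hsum)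
  · have : 0 < b := ha.trans hab
    positivity
  · simp only [Function.comp_apply]
    rw [Finset.mul_sum, ← Finset.sum_neg_distrib, Real.exp_sum]
    have hb0 : 0 < b := ha.trans hab
    refine Finset.prod_le_prod (fun k _ => by positivity) fun k _ => ?_
    have hk : (0 : ℝ) < k + b := by positivity
    have h1 : ((k : ℝ) + a) / (k + b) = 1 - (b - a) * (1 / (k + b)) := by
      field_simp
      ring
    have h2 : 1 / ((k : ℝ) + 1) ≤ 1 / (k + b) := one_div_le_one_div_of_le hk (by linarith)
    have h3 := mul_le_mul_of_nonneg_left h2 (sub_nonneg.2 hab.le)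
    have h4 := Real.add_one_le_exp (-((b - a) * (1 / ((k : ℝ) + 1))))
    linarith

/-- The iterates of `T(a, b)` on the zeroth basis vector. -/
lemma iterate_wT_shift_apply {a b : ℝ} (ha : 0 < a) (hb : 0 < b) {T : H →L[ℂ] H}
    (hT : ∀ n : ℤ, T (e n) = wT a b n • e (n + 1)) (n : ℕ) :
    T^[n] (e 0) =
      ((√(∏ k ∈ Finset.range n, ((k : ℝ) + a) / ((k : ℝ) + b)) : ℝ) : ℂ) • e n := by
  induction n with
  | zero => simp
  | succ n ih =>
    rw [Function.iterate_succ_apply', ih, map_smul, hT, smul_smul, Finset.prod_range_succ,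
      Real.sqrt_mul (Finset.prod_nonneg fun k _ => by positivity), wT]
    push_cast
    rfl

lemma tendsto_iterate_wT_shift {a b : ℝ} (ha : 0 < a) (hab : a < b) (hb : b < 1)
    {T : H →L[ℂ] H} (hT : ∀ n : ℤ, T (e n) = wT a b n • e (n + 1)) :
    Filter.Tendsto (fun n => T^[n] (e 0)) Filter.atTop (nhds 0) := by
  rw [tendsto_zero_iff_norm_tendsto_zero]
  have h := (Real.continuous_sqrt.tendsto 0).comp (tendsto_prod_range_add_div_add ha hab hb)
  rw [Real.sqrt_zero] at h
  refine h.congr fun n => ?_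
  rw [iterate_wT_shift_apply ha (ha.trans hab) hT, norm_smul, Complex.norm_real,
    Real.norm_of_nonneg (Real.sqrt_nonneg _), e, lp.norm_single (by norm_num), norm_one, mul_one,
    Function.comp_apply]

/-- no `T(a, b, α)` is unitarily equivalent to any `B(λ, β)`. -/
theorem stmt6 (a b α : ℝ) (ha : 0 < a) (hab : a < b) (hb : b < 1) (hα : 0 < α)
    (l β : ℝ) (hl : -1 < l ∧ l < 1) (hβ : 0 < β)
    (T₁ T₂ B₀ Sl : H →L[ℂ] H)
    (hT₁ : ∀ n : ℤ, T₁ (e n) = wT a b n • e (n + 1))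
    (hT₂ : ∀ n : ℤ, T₂ (e n) = wT b a n • e (n + 1))
    (hB₀ : ∀ n : ℤ, B₀ (e n) = e (n + 1))
    (hSl : ∀ n : ℤ, Sl (e n) = wS l n • e (n + 1)) :
    ¬ UnitarilyEquiv (blockOp T₁ ((α : ℂ) • (T₁ - T₂)) T₂)
        (blockOp B₀ ((β : ℂ) • Sl) B₀) := by
  rintro ⟨U, hU⟩
  have hiter (n : ℕ) (x : WithLp 2 (H × H)) :
      U ((blockOp T₁ ((α : ℂ) • (T₁ - T₂)) T₂)^[n] x) =
        (blockOp B₀ ((β : ℂ) • Sl) B₀)^[n] (U x) :=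
    Function.Semiconj.iterate_right (f := U) hU n x
  have hstable : Filter.Tendsto
      (fun n => (blockOp T₁ ((α : ℂ) • (T₁ - T₂)) T₂)^[n] (WithLp.toLp 2 (e 0, 0)))
      Filter.atTop (nhds 0) := by
    have hpow (n : ℕ) : (blockOp T₁ ((α : ℂ) • (T₁ - T₂)) T₂)^[n] (WithLp.toLp 2 (e 0, 0)) =
        WithLp.toLp 2 (T₁^[n] (e 0), 0) :=
      (Function.Semiconj.iterate_right (f := fun x : H => WithLp.toLp 2 (x, (0 : H)))
        (fun x => (blockOp_toLp_zero T₁ _ T₂ x).symm) n (e 0)).symm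
    simp only [hpow]
    rw [tendsto_zero_iff_norm_tendsto_zero]
    simpa [WithLp.prod_norm_eq_of_L2] using (tendsto_iterate_wT_shift ha hab hb hT₁).norm
  have hUstable := (U.continuous.tendsto 0).comp hstable
  simp only [Function.comp_def, hiter, map_zero] at hUstable
  have h0 := eq_zero_of_tendsto_iterate_blockOp (norm_shift_apply hB₀) (norm_shift_apply hB₀)
    hUstable
  have he : e 0 = 0 := congrArg WithLp.fst ((map_eq_zero_iff U U.injective).1 h0)
  simpa [he] using inner_e 0 0
end
end
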